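/- Let n ≥ 3 and k ≥ 2 be integers and let H be a real number with 1/(tan(π/k))² < H < (k²−2)/n. Define q_C(v) = C − v^{2−n} − (H+1)v² for v > 0 (the case m = 2), let v₀ = ((n−2)/(2(H+1)))^{1/n} be its unique positive critical point and c₀ = ((n−2)/(2(H+1)))^{2/n}·n(H+1)/(n−2), and for C > c₀ let t₁(C) < v₀ < t₂(C) be the two positive zeros of q_C and P(H,2,n,C) = 2∫_{t₁(C)}^{t₂(C)} √C·t·(t^{−n}+H)^{1/2}/((C−t²)·√(q_C(t))) dt. Then there exists C > c₀ such that P(H,2,n,C) = 2π/k. -/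

import Mathlib

open Real Set Filter MeasureTheory

/-- The complete homogeneous symmetric polynomial of degree `k` in two variables. -/
def hsymmTwo (u v : ℝ) : ℕ → ℝ
  | 0 => 1
  | k + 1 => v * hsymmTwo u v k + u ^ (k + 1)

/-- The complete homogeneous symmetric polynomial of degree `k` in three variables. -/
def hsymmThree (u v w : ℝ) : ℕ → ℝ
  | 0 => 1
  | k + 1 => w * hsymmThree u v w k + hsymmTwo u v (k + 1)

lemma hsymmTwo_pos {u v : ℝ} (hu : 0 < u) (hv : 0 < v) (k : ℕ) : 0 < hsymmTwo u v k := by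
  induction k with
  | zero => simp [hsymmTwo]
  | succ k ih => simp only [hsymmTwo]; positivity

lemma hsymmThree_pos {u v w : ℝ} (hu : 0 < u) (hv : 0 < v) (hw : 0 < w) (k : ℕ) :
    0 < hsymmThree u v w k := by
  induction k with
  | zero => simp [hsymmThree]
  | succ k ih =>
    have := hsymmTwo_pos hu hv (k + 1)
    simp only [hsymmThree]; positivity

lemma hsymmTwo_le {u v : ℝ} (hu : 0 < u) (hv : 0 < v) (hux : u ≤ 1) (hvx : v ≤ 1) (k : ℕ) :
    hsymmTwo u v k ≤ k + 1 := by
  induction k with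
  | zero => simp [hsymmTwo]
  | succ k ih =>
    have h1 : v * hsymmTwo u v k ≤ 1 * hsymmTwo u v k :=
      mul_le_mul_of_nonneg_right hvx (hsymmTwo_pos hu hv k).le
    have h2 : u ^ (k + 1) ≤ 1 := pow_le_one₀ hu.le hux
    simp only [hsymmTwo]; push_cast; linarith

lemma hsymmTwo_self (u : ℝ) (k : ℕ) : hsymmTwo u u k = (k + 1) * u ^ k := by
  induction k with
  | zero => simp [hsymmTwo]
  | succ k ih => simp only [hsymmTwo, ih]; push_cast; ring

lemma hsymmThree_self (u : ℝ) (k : ℕ) :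
    hsymmThree u u u k = (k + 1) * (k + 2) / 2 * u ^ k := by
  induction k with
  | zero => simp [hsymmThree]
  | succ k ih => simp only [hsymmThree, ih, hsymmTwo_self]; push_cast; ring

lemma sub_mul_hsymmTwo (u v : ℝ) (k : ℕ) :
    (u - v) * hsymmTwo u v k = u ^ (k + 1) - v ^ (k + 1) := by
  induction k with
  | zero => simp [hsymmTwo]
  | succ k ih => simp only [hsymmTwo]; linear_combination v * ih

lemma hsymmTwo_mul (c u v : ℝ) (k : ℕ) :
    hsymmTwo (c * u) (c * v) k = c ^ k * hsymmTwo u v k := by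
  induction k with
  | zero => simp [hsymmTwo]
  | succ k ih => simp only [hsymmTwo, ih]; ring

lemma sub_mul_hsymmThree (u v w : ℝ) (k : ℕ) :
    (v - w) * hsymmThree u v w k = hsymmTwo u v (k + 1) - hsymmTwo u w (k + 1) := by
  induction k with
  | zero => simp [hsymmThree, hsymmTwo]
  | succ k ih =>
    simp only [hsymmThree]
    rw [hsymmTwo.eq_2 u v (k+1), hsymmTwo.eq_2 u w (k+1)]
    linear_combination w * ih

lemma continuous_hsymmTwo (k : ℕ) : Continuous fun x : ℝ × ℝ => hsymmTwo x.1 x.2 k := by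
  induction k with
  | zero => simpa [hsymmTwo] using continuous_const
  | succ k ih => simp only [hsymmTwo]; fun_prop

lemma continuous_hsymmThree (k : ℕ) :
    Continuous fun x : ℝ × ℝ × ℝ => hsymmThree x.1 x.2.1 x.2.2 k := by
  induction k with
  | zero => simpa [hsymmThree] using continuous_const
  | succ k ih =>
    have : Continuous fun x : ℝ × ℝ × ℝ => hsymmTwo x.1 x.2.1 (k + 1) :=
      (continuous_hsymmTwo (k + 1)).comp (by fun_prop : Continuous fun x : ℝ × ℝ × ℝ => (x.1, x.2.1))
    simp only [hsymmThree]; fun_prop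

/-- The function `v ↦ C - q_C(v)` for `n = d + 3`. -/
noncomputable def profile (d : ℕ) (H t : ℝ) : ℝ := t⁻¹ ^ (d + 1) + (H + 1) * t ^ 2

/-- The quotient of `q_C(t)` by `(t - a) * (b - t)`, where `a`, `b` are the zeros of `q_C`. -/
noncomputable def gapFactor (d : ℕ) (H a b t : ℝ) : ℝ :=
  H + 1 + a⁻¹ * b⁻¹ * t⁻¹ * hsymmThree b⁻¹ t⁻¹ a⁻¹ d

/-- The equation `profile d H a = profile d H b`, divided by `b - a`. -/
def ProfileBalanced (d : ℕ) (H a b : ℝ) : Prop :=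
  b⁻¹ * a⁻¹ * hsymmTwo b⁻¹ a⁻¹ d = (H + 1) * (a + b)

lemma profile_sub (d : ℕ) (H : ℝ) {s t : ℝ} (hs : s ≠ 0) (ht : t ≠ 0) :
    profile d H s - profile d H t =
      (s - t) * ((H + 1) * (s + t) - s⁻¹ * t⁻¹ * hsymmTwo s⁻¹ t⁻¹ d) := by
  have h := sub_mul_hsymmTwo s⁻¹ t⁻¹ d
  have e : (s - t) * (s⁻¹ * t⁻¹) = -(s⁻¹ - t⁻¹) := by field_simp; ring
  simp only [profile]
  linear_combination -h + hsymmTwo s⁻¹ t⁻¹ d * e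

lemma balanced_of_profile_eq {d : ℕ} {H a b : ℝ} (ha : a ≠ 0) (hb : b ≠ 0) (hab : a ≠ b)
    (h : profile d H a = profile d H b) : ProfileBalanced d H a b := by
  have := profile_sub d H hb ha
  rw [h, sub_self, zero_eq_mul] at this
  rcases this with h | h
  · exact absurd (sub_eq_zero.1 h).symm hab
  · rw [ProfileBalanced]; linarith

lemma ProfileBalanced.profile_sub_eq {d : ℕ} {H a b t : ℝ} (h : ProfileBalanced d H a b) (ha : a ≠ 0)
    (hb : b ≠ 0) (ht : t ≠ 0) :
    profile d H b - profile d H t = (t - a) * (b - t) * gapFactor d H a b t := by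
  rw [profile_sub d H hb ht]
  have h3 := sub_mul_hsymmThree b⁻¹ t⁻¹ a⁻¹ d
  simp only [hsymmTwo] at h3
  have e : (t - a) * (a⁻¹ * t⁻¹) = -(t⁻¹ - a⁻¹) := by field_simp; ring
  rw [ProfileBalanced] at h
  simp only [gapFactor]
  linear_combination (b - t) * (b⁻¹ * h3 - h - b⁻¹ * hsymmThree b⁻¹ t⁻¹ a⁻¹ d * e)

lemma ProfileBalanced.profile_eq {d : ℕ} {H a b : ℝ} (h : ProfileBalanced d H a b) (ha : a ≠ 0)
    (hb : b ≠ 0) : profile d H a = profile d H b := by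
  have := h.profile_sub_eq ha hb ha
  simp at this; linarith

lemma lt_gapFactor (d : ℕ) (H : ℝ) {a b t : ℝ} (ha : 0 < a) (hb : 0 < b) (ht : 0 < t) :
    H + 1 < gapFactor d H a b t := by
  have := hsymmThree_pos (inv_pos.2 hb) (inv_pos.2 ht) (inv_pos.2 ha) d
  have : 0 < a⁻¹ * b⁻¹ * t⁻¹ * hsymmThree b⁻¹ t⁻¹ a⁻¹ d := by positivity
  simp only [gapFactor]; linarith

lemma profile_add (d : ℕ) (H : ℝ) {t : ℝ} (ht : t ≠ 0) :
    profile d H t = t ^ 2 + t ^ 2 * (t⁻¹ ^ (d + 3) + H) := by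
  have e : t ^ 2 * t⁻¹ ^ 2 = 1 := by field_simp
  simp only [profile]; linear_combination (-t⁻¹ ^ (d + 1)) * e

/-- The integrand of the period function for `n = d + 3`. -/
noncomputable def periodIntegrand (d : ℕ) (H C t : ℝ) : ℝ :=
  √C * t * √(t⁻¹ ^ (d + 3) + H) / ((C - t ^ 2) * √(C - profile d H t))

/-- Affine image of `sin φ` running from `a` to `b`. -/
noncomputable def sinPath (a b φ : ℝ) : ℝ := (a + b) / 2 + (b - a) / 2 * Real.sin φ

/-- The period integrand after the substitution `t = sinPath a b φ`. -/
noncomputable def angularIntegrand (d : ℕ) (H a b φ : ℝ) : ℝ :=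
  √(profile d H b) * sinPath a b φ * √((sinPath a b φ)⁻¹ ^ (d + 3) + H) /
    ((profile d H b - sinPath a b φ ^ 2) * √(gapFactor d H a b (sinPath a b φ)))

lemma sinPath_mem_Icc {a b : ℝ} (hab : a ≤ b) (φ : ℝ) : sinPath a b φ ∈ Icc a b := by
  have h1 := Real.neg_one_le_sin φ
  have h2 := Real.sin_le_one φ
  simp only [sinPath, mem_Icc]
  constructor <;> nlinarith

lemma ProfileBalanced.sq_lt_profile {d : ℕ} {H a b t : ℝ} (h : ProfileBalanced d H a b) (hH : 0 < H)
    (ha : 0 < a) (ht : t ∈ Icc a b) : t ^ 2 < profile d H b := by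
  have ht0 : 0 < t := ha.trans_le ht.1
  have hb : 0 < b := ht0.trans_le ht.2
  have h1 := h.profile_sub_eq ha.ne' hb.ne' ht0.ne'
  have h2 : 0 ≤ (t - a) * (b - t) * gapFactor d H a b t :=
    mul_nonneg (mul_nonneg (sub_nonneg.2 ht.1) (sub_nonneg.2 ht.2))
      (by linarith [lt_gapFactor d H ha hb ht0])
  have h3 := profile_add d H ht0.ne'
  have : 0 < t ^ 2 * (t⁻¹ ^ (d + 3) + H) := by positivity
  linarith

lemma image_sinPath {a b : ℝ} (hab : a < b) :
    sinPath a b '' Ioo (-(π / 2)) (π / 2) = Ioo a b := by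
  ext t
  constructor
  · rintro ⟨φ, hφ, rfl⟩
    have h1 : Real.sin φ < 1 := by
      rw [← Real.sin_pi_div_two]
      exact Real.strictMonoOn_sin ⟨hφ.1.le, hφ.2.le⟩ ⟨by linarith [pi_pos], le_rfl⟩ hφ.2
    have h2 : -1 < Real.sin φ := by
      rw [← Real.sin_pi_div_two, ← Real.sin_neg]
      exact Real.strictMonoOn_sin ⟨le_rfl, by linarith [pi_pos]⟩ ⟨hφ.1.le, hφ.2.le⟩ hφ.1
    simp only [sinPath, mem_Ioo]
    constructor <;> nlinarith
  · rintro ⟨h1, h2⟩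
    have hd : 0 < b - a := sub_pos.2 hab
    set y := (2 * t - a - b) / (b - a) with hy
    have hy1 : -1 < y := by rw [hy, lt_div_iff₀ hd]; linarith
    have hy2 : y < 1 := by rw [hy, div_lt_iff₀ hd]; linarith
    refine ⟨Real.arcsin y, ⟨Real.neg_pi_div_two_lt_arcsin.2 hy1, Real.arcsin_lt_pi_div_two.2 hy2⟩, ?_⟩
    rw [sinPath, Real.sin_arcsin hy1.le hy2.le, hy]
    field_simp; ring

lemma ProfileBalanced.integral_eq {d : ℕ} {H a b : ℝ} (h : ProfileBalanced d H a b) (hH : 0 < H)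
    (ha : 0 < a) (hab : a < b) :
    ∫ t in a..b, periodIntegrand d H (profile d H b) t =
      ∫ φ in (-(π / 2))..(π / 2), angularIntegrand d H a b φ := by
  have hb : 0 < b := ha.trans hab
  have hd : 0 < (b - a) / 2 := by linarith
  rw [intervalIntegral.integral_of_le hab.le, integral_Ioc_eq_integral_Ioo, ← image_sinPath hab,
    intervalIntegral.integral_of_le (by linarith [pi_pos]), integral_Ioc_eq_integral_Ioo,
    integral_image_eq_integral_abs_deriv_smul (f' := fun φ => (b - a) / 2 * Real.cos φ)
      measurableSet_Ioo]
  · refine setIntegral_congr_fun measurableSet_Ioo fun φ hφ => ?_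
    have hc : 0 < Real.cos φ := Real.cos_pos_of_mem_Ioo hφ
    have ht := sinPath_mem_Icc hab.le φ
    have ht0 : 0 < sinPath a b φ := ha.trans_le ht.1
    have hr := lt_gapFactor d H ha hb ht0
    have hq : profile d H b - profile d H (sinPath a b φ) =
        ((b - a) / 2 * Real.cos φ) ^ 2 * gapFactor d H a b (sinPath a b φ) := by
      rw [h.profile_sub_eq ha.ne' hb.ne' ht0.ne']
      congr 1
      simp only [sinPath]
      linear_combination (-(b - a) ^ 2 / 4) * Real.sin_sq_add_cos_sq φ
    simp only [periodIntegrand, angularIntegrand, smul_eq_mul]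
    have hp : 0 < (b - a) / 2 * Real.cos φ := mul_pos hd hc
    rw [hq, Real.sqrt_mul (sq_nonneg _), Real.sqrt_sq hp.le, abs_of_pos hp]
    have := h.sq_lt_profile hH ha ht
    have h5 : 0 < √(gapFactor d H a b (sinPath a b φ)) := Real.sqrt_pos.2 (by linarith)
    have h6 : profile d H b - sinPath a b φ ^ 2 ≠ 0 := by linarith
    have h7 : b - a ≠ 0 := by linarith
    field_simp
  · intro φ _
    have := ((Real.hasDerivAt_sin φ).const_mul ((b - a) / 2)).const_add ((a + b) / 2)
    exact this.hasDerivWithinAt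
  · intro x hx y hy hxy
    simp only [sinPath, add_right_inj] at hxy
    exact Real.injOn_sin ⟨hx.1.le, hx.2.le⟩ ⟨hy.1.le, hy.2.le⟩ (mul_left_cancel₀ hd.ne' hxy)

lemma ProfileBalanced.continuous_integral {X : Type*} [TopologicalSpace X] {d : ℕ} {H : ℝ}
    {a b : X → ℝ} (hH : 0 < H) (hac : Continuous a) (hbc : Continuous b) (ha : ∀ x, 0 < a x)
    (hab : ∀ x, a x ≤ b x) (h : ∀ x, ProfileBalanced d H (a x) (b x)) :
    Continuous fun x => ∫ φ in (-(π / 2))..(π / 2), angularIntegrand d H (a x) (b x) φ := by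
  apply intervalIntegral.continuous_parametric_intervalIntegral_of_continuous'
  have hs : Continuous fun p : X × ℝ => sinPath (a p.1) (b p.1) p.2 := by
    simp only [sinPath]; fun_prop
  have hs0 : ∀ p : X × ℝ, 0 < sinPath (a p.1) (b p.1) p.2 := fun p =>
    (ha p.1).trans_le (sinPath_mem_Icc (hab p.1) p.2).1
  have hb : ∀ x, 0 < b x := fun x => (ha x).trans_le (hab x)
  have hsi := hs.inv₀ fun p => (hs0 p).ne'
  have hai : Continuous fun p : X × ℝ => (a p.1)⁻¹ :=
    (hac.comp continuous_fst).inv₀ fun p => (ha p.1).ne'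
  have hbi : Continuous fun p : X × ℝ => (b p.1)⁻¹ :=
    (hbc.comp continuous_fst).inv₀ fun p => (hb p.1).ne'
  have hC : Continuous fun p : X × ℝ => profile d H (b p.1) := by
    simp only [profile]; fun_prop
  have hr : Continuous fun p : X × ℝ =>
      gapFactor d H (a p.1) (b p.1) (sinPath (a p.1) (b p.1) p.2) := by
    have := (continuous_hsymmThree d).comp (hbi.prodMk (hsi.prodMk hai))
    simp only [gapFactor]
    exact continuous_const.add (((hai.mul hbi).mul hsi).mul this)
  refine Continuous.div ?_ ?_ fun p => ?_
  · exact (hC.sqrt.mul hs).mul ((hsi.pow _).add continuous_const).sqrt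
  · exact (hC.sub (hs.pow 2)).mul hr.sqrt
  · have h1 := (h p.1).sq_lt_profile hH (ha p.1) (sinPath_mem_Icc (hab p.1) p.2)
    have h2 := lt_gapFactor d H (ha p.1) (hb p.1) (hs0 p)
    exact mul_ne_zero (by linarith) (Real.sqrt_pos.2 (by linarith)).ne'

lemma profileBalanced_self_iff {d : ℕ} {H v : ℝ} (hv : 0 < v) :
    ProfileBalanced d H v v ↔ (d + 1) * v⁻¹ ^ (d + 3) = 2 * (H + 1) := by
  rw [ProfileBalanced, hsymmTwo_self]
  have e : v * v⁻¹ = 1 := mul_inv_cancel₀ hv.ne'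
  constructor
  · intro h
    linear_combination v⁻¹ * h + 2 * (H + 1) * e
  · intro h
    linear_combination v * h - (d + 1) * v⁻¹ ^ (d + 2) * e

lemma ProfileBalanced.profile_self {d : ℕ} {H v : ℝ} (hv : 0 < v) (h : ProfileBalanced d H v v) :
    profile d H v = v ^ 2 * ((d + 3) * (H + 1) / (d + 1)) := by
  rw [profileBalanced_self_iff hv] at h
  have e : v⁻¹ ^ (d + 3) = 2 * (H + 1) / (d + 1) := by
    rw [eq_div_iff (by positivity)]; linarith
  rw [profile_add d H hv.ne', e]
  field_simp; ring

lemma ProfileBalanced.angularIntegrand_self {d : ℕ} {H v : ℝ} (hH : 0 < H) (hv : 0 < v)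
    (h : ProfileBalanced d H v v) (φ : ℝ) :
    angularIntegrand d H v v φ = 1 / √((d + 3) * H + 2) := by
  have hp := h.profile_self hv
  rw [profileBalanced_self_iff hv] at h
  have e : v⁻¹ ^ (d + 3) = 2 * (H + 1) / (d + 1) := by
    rw [eq_div_iff (by positivity)]; linarith
  have hs : sinPath v v φ = v := by simp [sinPath]
  have hr : gapFactor d H v v v = (d + 3) * (H + 1) := by
    rw [gapFactor, hsymmThree_self]
    linear_combination (d + 2) / 2 * h
  have e2 : v⁻¹ ^ (d + 3) + H = ((d + 3) * H + 2) / (d + 1) := by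
    rw [e]; field_simp; ring
  have e3 : profile d H v - v ^ 2 = v ^ 2 * (((d + 3) * H + 2) / (d + 1)) := by
    rw [hp]; field_simp; ring
  rw [angularIntegrand, hs, hr, e3, e2, hp, Real.sqrt_mul (sq_nonneg v), Real.sqrt_sq hv.le,
    Real.sqrt_div (by positivity), Real.sqrt_div (by positivity)]
  have h1 : 0 < √((d + 3) * (H + 1)) := by positivity
  have h2 : 0 < √((d + 3) * H + 2) := by positivity
  have h3 : √((d : ℝ) + 1) ^ 2 = d + 1 := Real.sq_sqrt (by positivity)
  have h4 : √(((d : ℝ) + 3) * H + 2) ^ 2 = (d + 3) * H + 2 := Real.sq_sqrt (by positivity)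
  have h5 : 0 < √((d : ℝ) + 1) := by positivity
  have h6 : ((d + 3) * H + 2) / (d + 1) = (√((d + 3) * H + 2) / √((d : ℝ) + 1)) ^ 2 := by
    rw [div_pow, h3, h4]
  rw [h6]
  field_simp

lemma ProfileBalanced.profile_lt {d : ℕ} {H v t : ℝ} (hH : 0 < H) (hv : 0 < v)
    (h : ProfileBalanced d H v v) (ht : 0 < t) (hne : t ≠ v) : profile d H v < profile d H t := by
  have h1 := h.profile_sub_eq hv.ne' hv.ne' ht.ne'
  have h2 := lt_gapFactor d H hv hv ht
  have h3 : 0 < (t - v) ^ 2 := by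
    have := sub_ne_zero.2 hne
    positivity
  nlinarith

/-- The larger zero of `q_C` as a function of the quotient `x` of the two zeros. -/
noncomputable def upperZero (d : ℕ) (H x : ℝ) : ℝ :=
  (hsymmTwo 1 x⁻¹ d / ((H + 1) * x * (1 + x))) ^ ((1 : ℝ) / (d + 3))

lemma upperZero_pos (d : ℕ) {H x : ℝ} (hH : 0 < H) (hx : 0 < x) : 0 < upperZero d H x := by
  have := hsymmTwo_pos one_pos (inv_pos.2 hx) d
  exact Real.rpow_pos_of_pos (by positivity) _

lemma profileBalanced_mul_iff {d : ℕ} {H x b : ℝ} (hH : 0 < H) (hx : 0 < x) (hb : 0 < b) :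
    ProfileBalanced d H (x * b) b ↔ upperZero d H x = b := by
  have hpos := hsymmTwo_pos one_pos (inv_pos.2 hx) d
  have hs := hsymmTwo_mul b⁻¹ 1 x⁻¹ d
  have h1 : ProfileBalanced d H (x * b) b ↔
      hsymmTwo 1 x⁻¹ d / ((H + 1) * x * (1 + x)) = b ^ (d + 3) := by
    rw [mul_one] at hs
    rw [ProfileBalanced, mul_inv, mul_comm x⁻¹, hs, div_eq_iff (by positivity), inv_pow]
    field_simp
    constructor <;> intro h <;> linear_combination h
  rw [h1, upperZero]
  have hn : ((d + 3 : ℕ) : ℝ) ≠ 0 := by positivity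
  have e : (1 : ℝ) / (d + 3) = ((d + 3 : ℕ) : ℝ)⁻¹ := by push_cast; rw [one_div]
  rw [e, Real.rpow_inv_eq (by positivity) hb.le hn, Real.rpow_natCast]

lemma continuousOn_upperZero (d : ℕ) {H : ℝ} (hH : 0 < H) :
    ContinuousOn (upperZero d H) (Ioi 0) := by
  have hi : ContinuousOn (fun x : ℝ => x⁻¹) (Ioi 0) :=
    continuousOn_id.inv₀ fun x hx => (mem_Ioi.1 hx).ne'
  have h1 : ContinuousOn (fun x : ℝ => hsymmTwo 1 x⁻¹ d) (Ioi 0) :=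
    (continuous_hsymmTwo d).comp_continuousOn (continuousOn_const.prodMk hi)
  refine ContinuousOn.rpow_const (h1.div (by fun_prop) fun x hx => ?_) fun x hx => Or.inl ?_
  · have : 0 < x := hx
    positivity
  · have h0 : 0 < x := hx
    have := hsymmTwo_pos one_pos (inv_pos.2 h0) d
    positivity

lemma intervalIntegral_le_of_hasDerivAt {f g G : ℝ → ℝ} {a b : ℝ} (hab : a ≤ b)
    (hG : ContinuousOn G (Icc a b)) (hd : ∀ x ∈ Ioo a b, HasDerivAt G (g x) x)
    (hf : Measurable f) (h0 : ∀ x ∈ Ioo a b, 0 ≤ f x) (hfg : ∀ x ∈ Ioo a b, f x ≤ g x) :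
    IntervalIntegrable f volume a b ∧ ∫ x in a..b, f x ≤ G b - G a := by
  have hg : IntegrableOn g (Ioo a b) :=
    (intervalIntegral.integrableOn_deriv_of_nonneg hG hd
      fun x hx => (h0 x hx).trans (hfg x hx)).mono_set Ioo_subset_Ioc_self
  have hfi : IntegrableOn f (Ioo a b) := by
    refine Integrable.mono' hg hf.aestronglyMeasurable ?_
    filter_upwards [ae_restrict_mem measurableSet_Ioo] with x hx
    rw [Real.norm_of_nonneg (h0 x hx)]
    exact hfg x hx
  have hgi : IntervalIntegrable g volume a b := by
    rwa [intervalIntegrable_iff_integrableOn_Ioo_of_le hab]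
  refine ⟨by rwa [intervalIntegrable_iff_integrableOn_Ioo_of_le hab], ?_⟩
  rw [← intervalIntegral.integral_eq_sub_of_hasDerivAt_of_le hab hG hd hgi,
    intervalIntegral.integral_of_le hab, intervalIntegral.integral_of_le hab,
    integral_Ioc_eq_integral_Ioo, integral_Ioc_eq_integral_Ioo]
  exact setIntegral_mono_on hfi hg measurableSet_Ioo hfg

lemma measurable_periodIntegrand (d : ℕ) (H C : ℝ) : Measurable (periodIntegrand d H C) := by
  unfold periodIntegrand profile
  fun_prop

lemma ProfileBalanced.integral_lower_le {d : ℕ} {H a b M : ℝ} (h : ProfileBalanced d H a b)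
    (hH : 0 < H) (ha : 0 < a) (haM : a < M) (hM : 2 ≤ M) (hMb : M + M ^ 2 < b)
    (hC : profile d H b = M ^ 6) :
    IntervalIntegrable (periodIntegrand d H (M ^ 6)) volume a M ∧
      ∫ t in a..M, periodIntegrand d H (M ^ 6) t ≤ 4 * √M⁻¹ := by
  have hM0 : 0 < M := by linarith
  have hb : 0 < b := by nlinarith
  have hle : 4 / M * √(M - a) - 4 / M * √(a - a) ≤ 4 * √M⁻¹ := by
    have h1 : √(M - a) ≤ √M := Real.sqrt_le_sqrt (by linarith)
    have h2 : 4 * √M⁻¹ = 4 / M * √M := by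
      rw [Real.sqrt_inv]
      nth_rw 2 [← Real.sq_sqrt hM0.le]
      have := Real.sqrt_pos.2 hM0
      field_simp
    rw [h2, sub_self, Real.sqrt_zero, mul_zero, sub_zero]
    gcongr
  refine (intervalIntegral_le_of_hasDerivAt (G := fun t => 4 / M * √(t - a))
    (g := fun t => 2 / (M * √(t - a))) haM.le (by fun_prop) (fun t ht => ?_)
    (measurable_periodIntegrand _ _ _) (fun t ht => ?_) (fun t ht => ?_)).imp_right
    fun h => h.trans hle
  · have hta : 0 < t - a := sub_pos.2 ht.1
    have := (((hasDerivAt_id t).sub_const a).sqrt hta.ne').const_mul (4 / M)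
    refine this.congr_deriv ?_
    have := Real.sqrt_pos.2 hta
    simp only [id]
    field_simp; norm_num
  · have ht0 : 0 < t := ha.trans ht.1
    have := h.sq_lt_profile hH ha (t := t) ⟨ht.1.le, by nlinarith [ht.2]⟩
    rw [hC] at this
    have : 0 < M ^ 6 - t ^ 2 := by linarith
    unfold periodIntegrand
    positivity
  · have ht0 : 0 < t := ha.trans ht.1
    have hta : 0 < t - a := sub_pos.2 ht.1
    have hq := h.profile_sub_eq ha.ne' hb.ne' ht0.ne'
    rw [hC] at hq
    have hr := lt_gapFactor d H ha hb ht0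
    have hbt : M ^ 2 < b - t := by linarith [ht.2]
    have hbt0 : 0 < b - t := (sq_nonneg M).trans_lt hbt
    have hq1 : M ^ 2 * (t - a) ≤ M ^ 6 - profile d H t := by
      rw [hq]
      have : M ^ 2 * 1 ≤ (b - t) * gapFactor d H a b t := by gcongr; linarith
      nlinarith
    have hq2 : M * √(t - a) ≤ √(M ^ 6 - profile d H t) := by
      rw [← Real.sqrt_sq hM0.le, ← Real.sqrt_mul (sq_nonneg M), Real.sqrt_sq hM0.le]
      exact Real.sqrt_le_sqrt hq1
    have hn : t * √(t⁻¹ ^ (d + 3) + H) ≤ √(M ^ 6) := by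
      nth_rw 1 [← Real.sqrt_sq ht0.le]
      rw [← Real.sqrt_mul (sq_nonneg t)]
      apply Real.sqrt_le_sqrt
      have := profile_add d H ht0.ne'
      have : 0 < M ^ 2 * (t - a) := by positivity
      nlinarith
    have hd : M ^ 6 / 2 ≤ M ^ 6 - t ^ 2 := by
      have h1 : t ^ 2 ≤ M ^ 2 := by nlinarith [ht.2]
      have h2 : (2 : ℝ) ^ 4 ≤ M ^ 4 := by gcongr
      nlinarith [mul_le_mul_of_nonneg_left h2 (sq_nonneg M)]
    have hs := Real.sqrt_pos.2 hta
    have hd0 : 0 ≤ M ^ 6 - t ^ 2 := le_trans (by positivity) hd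
    unfold periodIntegrand
    calc √(M ^ 6) * t * √(t⁻¹ ^ (d + 3) + H) / ((M ^ 6 - t ^ 2) * √(M ^ 6 - profile d H t))
        = √(M ^ 6) * (t * √(t⁻¹ ^ (d + 3) + H)) /
          ((M ^ 6 - t ^ 2) * √(M ^ 6 - profile d H t)) := by ring
      _ ≤ √(M ^ 6) * √(M ^ 6) / (M ^ 6 / 2 * (M * √(t - a))) := by
        gcongr
      _ = 2 / (M * √(t - a)) := by
        rw [Real.mul_self_sqrt (by positivity)]
        field_simp

lemma profile_sub_ge {d : ℕ} {H b t M : ℝ} (hM : 1 ≤ M) (hMt : M ≤ t) (htb : t ≤ b) :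
    (b ^ 2 - t ^ 2) * (H + 1 - (d + 1) * M⁻¹) ≤ profile d H b - profile d H t := by
  have ht : 1 ≤ t := hM.trans hMt
  have hb : 1 ≤ b := ht.trans htb
  have hb1 : b⁻¹ ≤ 1 := inv_le_one_of_one_le₀ hb
  have ht1 : t⁻¹ ≤ 1 := inv_le_one_of_one_le₀ ht
  have hb0 : 0 < b⁻¹ := by positivity
  have ht0 : 0 < t⁻¹ := by positivity
  have h1 := hsymmTwo_le hb0 ht0 hb1 ht1 d
  have htM : t⁻¹ ≤ M⁻¹ := by gcongr
  have h2 : b⁻¹ * t⁻¹ * hsymmTwo b⁻¹ t⁻¹ d ≤ 1 * M⁻¹ * (d + 1) := by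
    have := (hsymmTwo_pos hb0 ht0 d).le
    gcongr
  have h3 : 0 ≤ (d + 1) * M⁻¹ := by positivity
  rw [profile_sub d H (by positivity) (by positivity),
    show b ^ 2 - t ^ 2 = (b - t) * (b + t) by ring, mul_assoc]
  refine mul_le_mul_of_nonneg_left ?_ (sub_nonneg.2 htb)
  nlinarith

lemma hasDerivAt_arctan_sqrt_div {b c t : ℝ} (hc : 0 < c) (ht : t ^ 2 < b ^ 2) :
    HasDerivAt (fun t => -(1 / c) * Real.arctan (√(b ^ 2 - t ^ 2) / c))
      (t / ((c ^ 2 + b ^ 2 - t ^ 2) * √(b ^ 2 - t ^ 2))) t := by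
  have hp : 0 < b ^ 2 - t ^ 2 := sub_pos.2 ht
  have h1 := (((hasDerivAt_pow 2 t).const_sub (b ^ 2)).sqrt hp.ne').div_const c
  have h2 := h1.arctan.const_mul (-(1 / c))
  refine h2.congr_deriv ?_
  have hs := Real.sqrt_pos.2 hp
  rw [div_pow, Real.sq_sqrt hp.le]
  have : 0 < c ^ 2 + b ^ 2 - t ^ 2 := by nlinarith
  have : 0 < c ^ 2 + (b ^ 2 - t ^ 2) := by nlinarith
  field_simp
  simp; ring

lemma ProfileBalanced.integral_upper_le {d : ℕ} {H a b M : ℝ} (h : ProfileBalanced d H a b)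
    (hH : 0 < H) (ha : 0 < a) (haM : a < M) (hM : 2 ≤ M) (hMb : M < b)
    (hK : (d + 1) * M⁻¹ < H + 1) (hC : profile d H b = M ^ 6) :
    IntervalIntegrable (periodIntegrand d H (M ^ 6)) volume M b ∧
      ∫ t in M..b, periodIntegrand d H (M ^ 6) t ≤
        √(H + M⁻¹) / √(H + 1 - (d + 1) * M⁻¹) * (√(H + 1) / √H * Real.arctan (1 / √H)) := by
  have hM0 : 0 < M := by linarith
  have hb : 0 < b := by linarith
  have hK0 := sub_pos.2 hK
  have hsH := Real.sqrt_pos.2 hH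
  set D := √(H + M⁻¹) / √(H + 1 - (d + 1) * M⁻¹) with hD
  have hCb : (H + 1) * b ^ 2 ≤ M ^ 6 := by
    have : 0 < b⁻¹ ^ (d + 1) := by positivity
    rw [← hC, profile]; linarith
  have hCb0 : 0 < M ^ 6 - b ^ 2 := by nlinarith [sq_pos_of_pos hb]
  set c := √(M ^ 6 - b ^ 2) with hc
  have hc0 : 0 < c := Real.sqrt_pos.2 hCb0
  have hcsq : c ^ 2 = M ^ 6 - b ^ 2 := Real.sq_sqrt hCb0.le
  have hle : D * √(M ^ 6) * (-(1 / c) * Real.arctan (√(b ^ 2 - b ^ 2) / c)) -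
      D * √(M ^ 6) * (-(1 / c) * Real.arctan (√(b ^ 2 - M ^ 2) / c)) ≤
        D * (√(H + 1) / √H * Real.arctan (1 / √H)) := by
    rw [sub_self, Real.sqrt_zero, zero_div, Real.arctan_zero]
    have h1 : √(M ^ 6) / c ≤ √(H + 1) / √H := by
      rw [hc, ← Real.sqrt_div' _ hCb0.le, ← Real.sqrt_div' _ hH.le]
      apply Real.sqrt_le_sqrt
      rw [div_le_div_iff₀ hCb0 hH]; nlinarith
    have h2 : √(b ^ 2 - M ^ 2) / c ≤ 1 / √H := by
      rw [hc, ← Real.sqrt_div' _ hCb0.le, ← Real.sqrt_one, ← Real.sqrt_div' _ hH.le]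
      apply Real.sqrt_le_sqrt
      rw [div_le_div_iff₀ hCb0 hH]; nlinarith
    have h3 := Real.arctan_mono h2
    have h4 : 0 ≤ Real.arctan (√(b ^ 2 - M ^ 2) / c) := Real.arctan_nonneg.2 (by positivity)
    calc _ = D * (√(M ^ 6) / c * Real.arctan (√(b ^ 2 - M ^ 2) / c)) := by ring
      _ ≤ _ := by gcongr
  refine (intervalIntegral_le_of_hasDerivAt
    (G := fun t => D * √(M ^ 6) * (-(1 / c) * Real.arctan (√(b ^ 2 - t ^ 2) / c)))
    (g := fun t => D * √(M ^ 6) * (t / ((c ^ 2 + b ^ 2 - t ^ 2) * √(b ^ 2 - t ^ 2))))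
    hMb.le ?_ (fun t ht => ?_)
    (measurable_periodIntegrand _ _ _) (fun t ht => ?_) (fun t ht => ?_)).imp_right
    fun h => h.trans hle
  · fun_prop
  · exact (hasDerivAt_arctan_sqrt_div hc0 (by nlinarith [ht.1, ht.2])).const_mul _
  · have ht0 : 0 < t := hM0.trans ht.1
    have := h.sq_lt_profile hH ha (t := t) ⟨by linarith [ht.1], ht.2.le⟩
    rw [hC] at this
    have : 0 < M ^ 6 - t ^ 2 := by linarith
    unfold periodIntegrand
    positivity
  · have ht0 : 0 < t := hM0.trans ht.1
    have hq := profile_sub_ge (d := d) (H := H) (by linarith) ht.1.le ht.2.le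
    rw [hC] at hq
    have hbt : 0 < b ^ 2 - t ^ 2 := by nlinarith [ht.2]
    have hq2 : √(b ^ 2 - t ^ 2) * √(H + 1 - (d + 1) * M⁻¹) ≤ √(M ^ 6 - profile d H t) := by
      rw [← Real.sqrt_mul hbt.le]
      exact Real.sqrt_le_sqrt hq
    have hn : t⁻¹ ^ (d + 3) ≤ M⁻¹ := by
      have h1 : t⁻¹ ≤ 1 := inv_le_one_of_one_le₀ (by linarith [ht.1])
      have h2 : t⁻¹ ≤ M⁻¹ := by
        have := ht.1.le
        gcongr
      exact (pow_le_of_le_one (by positivity) h1 (by omega)).trans h2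
    have hCt : 0 < M ^ 6 - t ^ 2 := by linarith
    have hs := Real.sqrt_pos.2 hbt
    have hsK := Real.sqrt_pos.2 hK0
    have hn2 : √(t⁻¹ ^ (d + 3) + H) ≤ √(H + M⁻¹) := Real.sqrt_le_sqrt (by linarith)
    rw [hcsq, sub_add_cancel]
    unfold periodIntegrand
    calc √(M ^ 6) * t * √(t⁻¹ ^ (d + 3) + H) / ((M ^ 6 - t ^ 2) * √(M ^ 6 - profile d H t))
        ≤ √(M ^ 6) * t * √(H + M⁻¹) /
          ((M ^ 6 - t ^ 2) * (√(b ^ 2 - t ^ 2) * √(H + 1 - (d + 1) * M⁻¹))) := by gcongr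
      _ = D * √(M ^ 6) * (t / ((M ^ 6 - t ^ 2) * √(b ^ 2 - t ^ 2))) := by
        rw [hD]; field_simp

lemma ProfileBalanced.mem_Ioo {d : ℕ} {H a b t : ℝ} (h : ProfileBalanced d H a b) (hH : 0 < H)
    (ha : 0 < a) (hab : a < b) (ht : 0 < t) (hq : profile d H t < profile d H b) :
    t ∈ Ioo a b := by
  have hb := ha.trans hab
  have h1 := h.profile_sub_eq ha.ne' hb.ne' ht.ne'
  have hr := lt_gapFactor d H ha hb ht
  have h2 : 0 < (t - a) * (b - t) :=
    pos_of_mul_pos_left (by rw [← h1]; linarith) (by linarith : 0 ≤ gapFactor d H a b t)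
  rcases pos_and_pos_or_neg_and_neg_of_mul_pos h2 with h | h
  · exact ⟨by linarith, by linarith⟩
  · linarith

lemma ProfileBalanced.eq_or_eq {d : ℕ} {H a b t : ℝ} (h : ProfileBalanced d H a b) (hH : 0 < H)
    (ha : 0 < a) (hb : 0 < b) (ht : 0 < t) (hq : profile d H t = profile d H b) :
    t = a ∨ t = b := by
  have h1 := h.profile_sub_eq ha.ne' hb.ne' ht.ne'
  have hr := lt_gapFactor d H ha hb ht
  rw [hq, sub_self, zero_eq_mul, mul_eq_zero] at h1
  rcases h1 with (h1 | h1) | h1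
  · left; linarith
  · right; linarith
  · linarith

lemma eventually_integral_lt (d : ℕ) {H L : ℝ} (hH : 0 < H) (hL : Real.arctan (1 / √H) < L) :
    ∀ᶠ M : ℝ in atTop, ∀ a b, ProfileBalanced d H a b → 0 < a → a < b → profile d H b = M ^ 6 →
      ∫ t in a..b, periodIntegrand d H (M ^ 6) t < L := by
  set E : ℝ → ℝ := fun x => 4 * √x + √(H + x) / √(H + 1 - (d + 1) * x) *
    (√(H + 1) / √H * Real.arctan (1 / √H)) with hE
  have hsH := Real.sqrt_pos.2 hH
  have hsH1 : 0 < √(H + 1) := by positivity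
  have hE0 : E 0 = Real.arctan (1 / √H) := by
    simp only [hE, Real.sqrt_zero, mul_zero, zero_add, add_zero, sub_zero]
    field_simp
  have hEc : ContinuousAt E 0 := by
    have h1 : √(H + 1 - (d + 1) * 0) ≠ 0 := by rw [mul_zero, sub_zero]; exact hsH1.ne'
    have h2 : ContinuousAt (fun x : ℝ => √(H + x)) 0 := by fun_prop
    have h3 : ContinuousAt (fun x : ℝ => √(H + 1 - (d + 1) * x)) 0 := by fun_prop
    have h4 : ContinuousAt (fun x : ℝ => 4 * √x) 0 := by fun_prop
    exact h4.add ((h2.div h3 h1).mul continuousAt_const)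
  have hK : ContinuousAt (fun x : ℝ => ((d : ℝ) + 1) * x) 0 := by fun_prop
  have h1 : ∀ᶠ M : ℝ in atTop, E M⁻¹ < L :=
    tendsto_inv_atTop_zero.eventually (hEc.eventually_lt_const (by rwa [hE0]))
  have h2 : ∀ᶠ M : ℝ in atTop, (d + 1) * M⁻¹ < H + 1 :=
    tendsto_inv_atTop_zero.eventually (hK.eventually_lt_const (by simp; linarith))
  filter_upwards [h1, h2, eventually_gt_atTop 2, eventually_gt_atTop (4 * (H + 1) + 1)]
    with M hM1 hM2 hM3 hM4 a b h ha hab hC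
  have hM0 : 0 < M := by linarith
  have key : ∀ t, M ≤ t → t ≤ M + M ^ 2 → t ∈ Ioo a b := by
    intro t ht1 ht2
    have ht0 : 0 < t := hM0.trans_le ht1
    refine h.mem_Ioo hH ha hab ht0 ?_
    rw [hC, profile]
    have h3 : t⁻¹ ^ (d + 1) ≤ 1 :=
      pow_le_one₀ (by positivity) (inv_le_one_of_one_le₀ (by linarith))
    have h4 : t ^ 2 ≤ (2 * M ^ 2) ^ 2 := by
      gcongr; nlinarith
    have h5 : 1 ≤ M ^ 4 := one_le_pow₀ (by linarith)
    have h6 : (4 * (H + 1) + 1) * M ^ 4 < M ^ 2 * M ^ 4 := by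
      gcongr; nlinarith
    nlinarith
  have hMI := key M le_rfl (by nlinarith)
  have hMI2 := key (M + M ^ 2) (by nlinarith) le_rfl
  obtain ⟨hi1, hl⟩ := h.integral_lower_le hH ha hMI.1 hM3.le hMI2.2 hC
  obtain ⟨hi2, hu⟩ := h.integral_upper_le hH ha hMI.1 hM3.le hMI.2 hM2 hC
  rw [← intervalIntegral.integral_add_adjacent_intervals hi1 hi2]
  exact (add_le_add hl hu).trans_lt hM1

lemma arctan_one_div_sqrt_lt {k : ℕ} (hk : 2 ≤ k) {H : ℝ} (hH : 0 < H)
    (h : 1 / Real.tan (π / k) ^ 2 < H) : Real.arctan (1 / √H) < π / k := by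
  rcases hk.eq_or_lt with rfl | hk
  · exact_mod_cast Real.arctan_lt_pi_div_two _
  · have hk' : (2 : ℝ) < k := by exact_mod_cast hk
    have h0 : 0 < π / k := by positivity
    have h2 : π / k < π / 2 := by gcongr
    have ht := Real.tan_pos_of_pos_of_lt_pi_div_two h0 h2
    rw [← Real.arctan_tan (by linarith) h2]
    apply Real.arctan_strictMono
    have hs := Real.sqrt_pos.2 hH
    rw [div_lt_iff₀ hs]
    rw [div_lt_iff₀ (by positivity)] at h
    have := Real.sq_sqrt hH.le
    by_contra! hc
    have : (Real.tan (π / k) * √H) ^ 2 ≤ 1 := pow_le_one₀ (by positivity) hc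
    nlinarith

/-- Analytic core of Proposition 5.2: for `n ≥ 3`, `k ≥ 2` and
`1/(tan(π/k))² < H < (k²-2)/n`, there exists `C > c₀` such that the period
`P(H,2,n,C) = 2∫_{t₁(C)}^{t₂(C)} √C t (t^{-n}+H)^{1/2} / ((C-t²)√(q_C(t))) dt`
equals `2π/k`.  Here `q_C(v) = C - v^{2-n} - (H+1)v²`,
`v₀ = ((n-2)/(2(H+1)))^{1/n}` is its unique positive critical point,
`c₀ = ((n-2)/(2(H+1)))^{2/n}·n(H+1)/(n-2)`, and `t₁(C) < v₀ < t₂(C)` are the two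
positive zeros of `q_C` for `C > c₀`. -/
theorem exists_period_m2 (n k : ℕ) (hn : 3 ≤ n) (hk : 2 ≤ k) (H : ℝ)
    (h1 : 1 / Real.tan (π / k) ^ 2 < H)
    (h2 : H < ((k : ℝ) ^ 2 - 2) / n)
    (t₁ t₂ : ℝ → ℝ)
    (hroots : ∀ C : ℝ,
      (((n : ℝ) - 2) / (2 * (H + 1))) ^ ((2 : ℝ) / n) * ((n : ℝ) * (H + 1) / ((n : ℝ) - 2))
        < C →
      0 < t₁ C ∧ t₁ C < (((n : ℝ) - 2) / (2 * (H + 1))) ^ ((1 : ℝ) / n) ∧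
      (((n : ℝ) - 2) / (2 * (H + 1))) ^ ((1 : ℝ) / n) < t₂ C ∧
      C - (t₁ C) ^ ((2 : ℝ) - n) - (H + 1) * (t₁ C) ^ 2 = 0 ∧
      C - (t₂ C) ^ ((2 : ℝ) - n) - (H + 1) * (t₂ C) ^ 2 = 0 ∧
      ∀ t ∈ Set.Ioo (t₁ C) (t₂ C), 0 < C - t ^ ((2 : ℝ) - n) - (H + 1) * t ^ 2) :
    ∃ C : ℝ,
      (((n : ℝ) - 2) / (2 * (H + 1))) ^ ((2 : ℝ) / n) * ((n : ℝ) * (H + 1) / ((n : ℝ) - 2))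
        < C ∧
      2 * ∫ t in (t₁ C)..(t₂ C),
          Real.sqrt C * t * (t ^ (-(n : ℝ)) + H) ^ ((1 : ℝ) / 2) /
            ((C - t ^ 2) * Real.sqrt (C - t ^ ((2 : ℝ) - n) - (H + 1) * t ^ 2)) =
        2 * π / k := by
  obtain ⟨d, rfl⟩ : ∃ d, n = d + 3 := ⟨n - 3, by omega⟩
  have hH : 0 < H := lt_of_le_of_lt (by positivity) h1
  have hk0 : (0 : ℝ) < k := by positivity
  have rpow_two_sub : ∀ t : ℝ, 0 < t → t ^ ((2 : ℝ) - (d + 3 : ℕ)) = t⁻¹ ^ (d + 1) := by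
    intro t ht
    rw [show (2 : ℝ) - (d + 3 : ℕ) = -((d + 1 : ℕ) : ℝ) by push_cast; ring,
      Real.rpow_neg ht.le, Real.rpow_natCast, inv_pow]
  have rpow_neg_n : ∀ t : ℝ, 0 < t → t ^ (-((d + 3 : ℕ) : ℝ)) = t⁻¹ ^ (d + 3) := by
    intro t ht
    rw [Real.rpow_neg ht.le, Real.rpow_natCast, inv_pow]
  have sub_profile : ∀ C t : ℝ, 0 < t →
      C - t ^ ((2 : ℝ) - (d + 3 : ℕ)) - (H + 1) * t ^ 2 = C - profile d H t := by
    intro C t ht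
    rw [rpow_two_sub t ht, profile]; ring
  have e1 : ((d + 3 : ℕ) : ℝ) - 2 = d + 1 := by push_cast; ring
  have e0 : ((d + 3 : ℕ) : ℝ) = d + 3 := by push_cast; ring
  set v := (((d + 3 : ℕ) : ℝ) - 2) / (2 * (H + 1)) with hv
  have hv0 : 0 < v := by rw [hv, e1]; positivity
  set v₀ := v ^ ((1 : ℝ) / (d + 3 : ℕ)) with hv₀
  have hv₀0 : 0 < v₀ := Real.rpow_pos_of_pos hv0 _
  have hpow : v₀ ^ (d + 3) = v := by
    rw [hv₀, ← Real.rpow_natCast, ← Real.rpow_mul hv0.le, one_div_mul_cancel (by positivity),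
      Real.rpow_one]
  have hcrit : ProfileBalanced d H v₀ v₀ := by
    rw [profileBalanced_self_iff hv₀0, inv_pow, hpow, hv, e1]
    field_simp
  have hc₀ : v ^ ((2 : ℝ) / (d + 3 : ℕ)) *
      (((d + 3 : ℕ) : ℝ) * (H + 1) / (((d + 3 : ℕ) : ℝ) - 2)) = profile d H v₀ := by
    rw [hcrit.profile_self hv₀0, e1, e0, hv₀, ← Real.rpow_natCast _ 2, ← Real.rpow_mul hv0.le]
    congr 2
    push_cast; ring
  rw [hc₀] at hroots ⊢
  have roots : ∀ C, profile d H v₀ < C → 0 < t₁ C ∧ t₁ C < t₂ C ∧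
      ProfileBalanced d H (t₁ C) (t₂ C) ∧ profile d H (t₂ C) = C := by
    intro C hC
    obtain ⟨r1, r2, r3, r4, r5, -⟩ := hroots C hC
    have r6 := r2.trans r3
    rw [sub_profile _ _ r1] at r4
    rw [sub_profile _ _ (r1.trans r6)] at r5
    exact ⟨r1, r6, balanced_of_profile_eq r1.ne' (r1.trans r6).ne' r6.ne (by linarith),
      by linarith⟩
  suffices h : ∃ C, profile d H v₀ < C ∧
      ∫ t in (t₁ C)..(t₂ C), periodIntegrand d H C t = π / k by
    obtain ⟨C, hC, hI⟩ := h
    refine ⟨C, hC, ?_⟩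
    obtain ⟨r1, r2, -, -⟩ := roots C hC
    rw [mul_div_assoc, ← hI]
    congr 1
    rw [intervalIntegral.integral_of_le r2.le, intervalIntegral.integral_of_le r2.le]
    refine setIntegral_congr_fun measurableSet_Ioc fun t ht => ?_
    have ht0 : 0 < t := r1.trans ht.1
    simp only [periodIntegrand]
    rw [sub_profile C t ht0, rpow_neg_n t ht0, ← Real.sqrt_eq_rpow]
  obtain ⟨M, hM, hMc⟩ := ((eventually_integral_lt d hH (arctan_one_div_sqrt_lt hk hH h1)).and
    ((tendsto_pow_atTop (by norm_num : (6 : ℕ) ≠ 0)).eventually_gt_atTop (profile d H v₀))).exists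
  obtain ⟨r1, r2, r3, r4⟩ := roots (M ^ 6) hMc
  have hI := hM _ _ r3 r1 r2 r4
  have hIa := r3.integral_eq hH r1 r2
  rw [r4] at hIa
  rw [hIa] at hI
  set a := t₁ (M ^ 6)
  set b := t₂ (M ^ 6)
  have hb : 0 < b := r1.trans r2
  set x₀ := a / b with hx₀
  have hx₀0 : 0 < x₀ := div_pos r1 hb
  have hx₀1 : x₀ < 1 := (div_lt_one hb).2 r2
  have hab : a = x₀ * b := by rw [hx₀]; field_simp
  have hub : upperZero d H x₀ = b := by
    rw [← profileBalanced_mul_iff hH hx₀0 hb, ← hab]; exact r3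
  have bal : ∀ x, 0 < x → ProfileBalanced d H (x * upperZero d H x) (upperZero d H x) :=
    fun x hx => (profileBalanced_mul_iff hH hx (upperZero_pos d hH hx)).2 rfl
  set P : ℝ → ℝ := fun x => ∫ φ in (-(π / 2))..(π / 2),
    angularIntegrand d H (x * upperZero d H x) (upperZero d H x) φ with hP
  have hPc : ContinuousOn P (Icc x₀ 1) := by
    rw [continuousOn_iff_continuous_domRestrict]
    have hpos : ∀ x : Icc x₀ 1, 0 < (x : ℝ) := fun x => hx₀0.trans_le x.2.1
    have hc : Continuous fun x : Icc x₀ 1 => upperZero d H x :=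
      (continuousOn_upperZero d hH).comp_continuous continuous_subtype_val hpos
    refine ProfileBalanced.continuous_integral hH (continuous_subtype_val.mul hc) hc
      (fun x => mul_pos (hpos x) (upperZero_pos d hH (hpos x)))
      (fun x => mul_le_of_le_one_left (upperZero_pos d hH (hpos x)).le x.2.2)
      (fun x => bal x (hpos x))
  have hP0 : P x₀ < π / k := by
    simp only [hP]
    rwa [hub, ← hab]
  have hP1 : π / k < P 1 := by
    have hb1 := bal 1 one_pos
    have hpos := upperZero_pos d hH one_pos
    simp only [hP]
    rw [one_mul] at hb1 ⊢
    simp only [hb1.angularIntegrand_self hH hpos, intervalIntegral.integral_const, smul_eq_mul]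
    rw [mul_one_div, show π / 2 - -(π / 2) = π by ring]
    have hs : √((d + 3) * H + 2) < k := by
      rw [Real.sqrt_lt' hk0]
      rw [lt_div_iff₀ (by positivity), e0] at h2
      linarith
    gcongr
  obtain ⟨x, hx, hxP⟩ := intermediate_value_Ioo hx₀1.le hPc ⟨hP0, hP1⟩
  have hx0 : 0 < x := hx₀0.trans hx.1
  have hB := bal x hx0
  have hB0 := upperZero_pos d hH hx0
  have hA0 : 0 < x * upperZero d H x := mul_pos hx0 hB0
  have hAB : x * upperZero d H x < upperZero d H x := mul_lt_of_lt_one_left hB0 hx.2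
  have hPx := hB.integral_eq hH hA0 hAB
  have hAC := hB.profile_eq hA0.ne' hB0.ne'
  set A := x * upperZero d H x
  set B := upperZero d H x
  have hC : profile d H v₀ < profile d H B := by
    by_cases h : B = v₀
    · rw [← hAC]
      exact hcrit.profile_lt hH hv₀0 hA0 (by rw [← h]; exact hAB.ne)
    · exact hcrit.profile_lt hH hv₀0 hB0 h
  refine ⟨profile d H B, hC, ?_⟩
  obtain ⟨s1, s2, s3, s4⟩ := roots _ hC
  have hA := s3.eq_or_eq hH s1 (s1.trans s2) hA0 (by rw [s4, hAC])
  have hB' := s3.eq_or_eq hH s1 (s1.trans s2) hB0 (by rw [s4])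
  have hA1 : t₁ (profile d H B) = A := by
    rcases hA with h | h
    · exact h.symm
    · rcases hB' with h' | h' <;> linarith
  have hB1 : t₂ (profile d H B) = B := by
    rcases hB' with h | h
    · rcases hA with h' | h' <;> linarith
    · exact h.symm
  rw [hA1, hB1, hPx]
  exact hxP
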